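/- Let L be a Lie ring, let n, m ≥ 1, and let x₁, …, xₙ, y₁, …, y_m ∈ L. Then ⁅[x₁,…,xₙ], [y₁,…,y_m]⁆ = Σ_α (−1)^{h(α)} [x_{α(1)}, …, x_{α(n)}, y₁, …, y_m], where the sum runs over all unimodal permutations α of {1,…,n} (i.e. there is some s with α(i) < α(i+1) for all i < s and α(i) > α(i+1) for all i with s ≤ i < n; necessarily α(s) = n) and h(α) = n − s. -/

import Mathlib

open scoped Classical

/-- The right-normed bracket `[x₁,…,xₙ] = ⁅x₁, [x₂,…,xₙ]⁆` of a list of elements of a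
Lie ring, with the conventions `[x] = x` and `[] = 0`. -/
def rightBracket {L : Type*} [LieRing L] : List L → L
  | [] => 0
  | [x] => x
  | x :: y :: ys => ⁅x, rightBracket (y :: ys)⁆

/-- A permutation `α` of `{0,…,n-1}` is unimodal with peak at (0-based) position `p` if
`α j < α (j+1)` for all `j < p` and `α (j+1) < α j` for all `j ≥ p`.  (In the 1-based
indexing of the paper this is the peak position `s = p + 1`, and `h(α) = n - s = n - 1 - p`.) -/
def IsUnimodalPeak {n : ℕ} (α : Equiv.Perm (Fin n)) (p : ℕ) : Prop :=
  p < n ∧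
  (∀ (j : ℕ) (hj : j + 1 < n), j < p →
      α ⟨j, Nat.lt_of_succ_lt hj⟩ < α ⟨j + 1, hj⟩) ∧
  (∀ (j : ℕ) (hj : j + 1 < n), p ≤ j →
      α ⟨j + 1, hj⟩ < α ⟨j, Nat.lt_of_succ_lt hj⟩)

theorem rb_append {L : Type*} [LieRing L] (l ys : List L) (h : ys ≠ []) :
    rightBracket (l ++ ys) = l.foldr (fun a b => ⁅a, b⁆) (rightBracket ys) := by
  induction l with
  | nil => rfl
  | cons a l ih =>
    have : l ++ ys ≠ [] := by simp [h]
    rw [List.foldr_cons, ← ih, List.cons_append]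
    cases hl : l ++ ys with
    | nil => exact absurd hl this
    | cons b t => rfl

/-- extend a permutation by fixing zero in front -/
def extA {n : ℕ} (σ : Equiv.Perm (Fin n)) : Equiv.Perm (Fin (n + 1)) :=
  Equiv.Perm.decomposeFin.symm (0, σ)

/-- extend a permutation by putting zero last -/
def extB {n : ℕ} (σ : Equiv.Perm (Fin n)) : Equiv.Perm (Fin (n + 1)) :=
  (finRotate (n + 1)).trans (extA σ)

theorem extA_zero {n : ℕ} (σ : Equiv.Perm (Fin n)) : extA σ 0 = 0 := by
  simp [extA]

theorem extA_succ {n : ℕ} (σ : Equiv.Perm (Fin n)) (i : Fin n) :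
    extA σ i.succ = (σ i).succ := by
  simp [extA]

theorem extB_last {n : ℕ} (σ : Equiv.Perm (Fin n)) : extB σ (Fin.last n) = 0 := by
  simp [extB, extA_zero, finRotate_last]

theorem extB_castSucc {n : ℕ} (σ : Equiv.Perm (Fin n)) (i : Fin n) :
    extB σ i.castSucc = (σ i).succ := by
  rw [← extA_succ]
  show extA σ (finRotate (n + 1) i.castSucc) = _
  congr 1
  exact finRotate_of_lt i.2

theorem extA_inj {n : ℕ} : Function.Injective (extA (n := n)) := by
  intro a b h
  have := Equiv.Perm.decomposeFin.symm.injective h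
  simpa using this

theorem extB_inj {n : ℕ} : Function.Injective (extB (n := n)) := by
  intro a b h
  ext i
  have := congrArg (fun f => f i.castSucc) h
  simp only [extB_castSucc] at this
  exact congrArg Fin.val (Fin.succ_injective _ this)

theorem extA_surj {n : ℕ} (τ : Equiv.Perm (Fin (n + 1))) (h : τ 0 = 0) :
    ∃ σ, extA σ = τ := by
  refine ⟨(Equiv.Perm.decomposeFin τ).2, ?_⟩
  have h1 : (Equiv.Perm.decomposeFin τ).1 = 0 := by
    have h2 : Equiv.Perm.decomposeFin.symm
      ((Equiv.Perm.decomposeFin τ).1, (Equiv.Perm.decomposeFin τ).2) 0 = 0 := by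
      simpa using h
    rwa [Equiv.Perm.decomposeFin_symm_apply_zero] at h2
  unfold extA
  rw [← h1]
  simp

theorem extB_surj {n : ℕ} (τ : Equiv.Perm (Fin (n + 1))) (h : τ (Fin.last n) = 0) :
    ∃ σ, extB σ = τ := by
  obtain ⟨σ, hσ⟩ := extA_surj ((finRotate (n + 1)).symm.trans τ) (by
    rw [Equiv.trans_apply, ← finRotate_last, Equiv.symm_apply_apply, h, finRotate_last])
  refine ⟨σ, ?_⟩
  rw [extB, hσ]
  ext i
  simp

theorem uni_extA {n : ℕ} (σ : Equiv.Perm (Fin (n + 1))) (p : ℕ) :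
    IsUnimodalPeak (extA σ) (p + 1) ↔ IsUnimodalPeak σ p := by
  constructor
  · rintro ⟨h1, h2, h3⟩
    refine ⟨by omega, fun j hj hp => ?_, fun j hj hp => ?_⟩
    · have := h2 (j + 1) (by omega) (by omega)
      have e1 := extA_succ σ ⟨j, by omega⟩
      have e2 := extA_succ σ ⟨j + 1, by omega⟩
      simp only [Fin.succ_mk] at e1 e2
      rw [e1, e2] at this
      simpa using this
    · have := h3 (j + 1) (by omega) (by omega)
      have e1 := extA_succ σ ⟨j, by omega⟩
      have e2 := extA_succ σ ⟨j + 1, by omega⟩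
      simp only [Fin.succ_mk] at e1 e2
      rw [e1, e2] at this
      simpa using this
  · rintro ⟨h1, h2, h3⟩
    refine ⟨by omega, fun j hj hp => ?_, fun j hj hp => ?_⟩
    · have e2 := extA_succ σ ⟨j, by omega⟩
      simp only [Fin.succ_mk] at e2
      rw [e2]
      cases j with
      | zero =>
        have := extA_zero σ
        simp only [Fin.mk_zero]
        rw [this]
        exact Fin.succ_pos _
      | succ j =>
        have e1 := extA_succ σ ⟨j, by omega⟩
        simp only [Fin.succ_mk] at e1
        rw [e1]
        exact Fin.succ_lt_succ_iff.2 (h2 j (by omega) (by omega))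
    · obtain ⟨j, rfl⟩ : ∃ k, j = k + 1 := ⟨j - 1, by omega⟩
      have e1 := extA_succ σ ⟨j, by omega⟩
      have e2 := extA_succ σ ⟨j + 1, by omega⟩
      simp only [Fin.succ_mk] at e1 e2
      rw [e1, e2]
      exact Fin.succ_lt_succ_iff.2 (h3 j (by omega) (by omega))

theorem uni_extB {n : ℕ} (σ : Equiv.Perm (Fin (n + 1))) (p : ℕ) (hpn : p < n + 1) :
    IsUnimodalPeak (extB σ) p ↔ IsUnimodalPeak σ p := by
  constructor
  · rintro ⟨h1, h2, h3⟩
    refine ⟨by omega, fun j hj hp => ?_, fun j hj hp => ?_⟩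
    · have := h2 j (by omega) (by omega)
      have e1 := extB_castSucc σ ⟨j, by omega⟩
      have e2 := extB_castSucc σ ⟨j + 1, by omega⟩
      simp only [Fin.castSucc_mk] at e1 e2
      rw [e1, e2] at this
      simpa using this
    · have := h3 j (by omega) (by omega)
      have e1 := extB_castSucc σ ⟨j, by omega⟩
      have e2 := extB_castSucc σ ⟨j + 1, by omega⟩
      simp only [Fin.castSucc_mk] at e1 e2
      rw [e1, e2] at this
      simpa using this
  · rintro ⟨h1, h2, h3⟩
    refine ⟨by omega, fun j hj hp => ?_, fun j hj hp => ?_⟩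
    · have e1 := extB_castSucc σ ⟨j, by omega⟩
      have e2 := extB_castSucc σ ⟨j + 1, by omega⟩
      simp only [Fin.castSucc_mk] at e1 e2
      rw [e1, e2]
      exact Fin.succ_lt_succ_iff.2 (h2 j (by omega) (by omega))
    · have e1 := extB_castSucc σ ⟨j, by omega⟩
      simp only [Fin.castSucc_mk] at e1
      rw [e1]
      by_cases hjn : j = n
      · subst hjn
        have : extB σ ⟨j + 1, hj⟩ = 0 := extB_last σ
        rw [this]
        exact Fin.succ_pos _
      · have e2 := extB_castSucc σ ⟨j + 1, by omega⟩
        simp only [Fin.castSucc_mk] at e2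
        rw [e2]
        exact Fin.succ_lt_succ_iff.2 (h3 j (by omega) (by omega))

theorem uni_last {n : ℕ} (τ : Equiv.Perm (Fin (n + 2))) (p : ℕ) (h : IsUnimodalPeak τ p)
    (h0 : τ 0 ≠ 0) : τ (Fin.last (n + 1)) = 0 := by
  obtain ⟨h1, h2, h3⟩ := h
  obtain ⟨k, hk⟩ := τ.surjective 0
  obtain ⟨k, hkn⟩ := k
  have hk0 : k ≠ 0 := by
    rintro rfl
    exact h0 hk
  by_cases hl : k = n + 1
  · subst hl
    exact hk
  exfalso
  obtain ⟨k, rfl⟩ : ∃ j, k = j + 1 := ⟨k - 1, by omega⟩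
  have a := h2 k (by omega)
  have b := h3 (k + 1) (by omega)
  rw [hk] at a b
  by_cases hp : k < p
  · exact absurd (a hp) (Fin.not_lt_zero _)
  · exact absurd (b (by omega)) (Fin.not_lt_zero _)

theorem main_foldr {L : Type*} [LieRing L] (n : ℕ) : ∀ (x : Fin (n + 1) → L) (z : L),
    ⁅rightBracket (List.ofFn x), z⁆ =
      ∑ σ ∈ Finset.univ.filter
          (fun σ : Equiv.Perm (Fin (n + 1)) × Fin (n + 1) => IsUnimodalPeak σ.1 σ.2.val),
        ((-1 : ℤ) ^ (n - σ.2.val)) •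
          (List.ofFn (fun i => x (σ.1 i))).foldr (fun a b => ⁅a, b⁆) z := by
  induction n with
  | zero =>
    intro x z
    rw [Finset.filter_true_of_mem]
    · haveI : Subsingleton (Fin (0 + 1)) := inferInstanceAs (Subsingleton (Fin 1))
      haveI : Subsingleton (Equiv.Perm (Fin (0 + 1)) × Fin (0 + 1)) :=
        ⟨fun a b => Prod.ext (Equiv.ext fun _ => Subsingleton.elim _ _) (Subsingleton.elim _ _)⟩
      rw [Fintype.sum_subsingleton _ ((1, 0) : Equiv.Perm (Fin (0 + 1)) × Fin (0 + 1))]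
      simp [rightBracket]
    · intro σ _
      exact ⟨σ.2.2, fun j hj => by omega, fun j hj => by omega⟩
  | succ n ih =>
    intro x z
    have hx : rightBracket (List.ofFn x)
        = ⁅x 0, rightBracket (List.ofFn (fun i : Fin (n + 1) => x i.succ))⁆ := by
      rw [List.ofFn_succ, List.ofFn_succ]
      rfl
    rw [hx, lie_lie, ih, ih, lie_sum, sub_eq_add_neg,
      ← Finset.sum_filter_add_sum_filter_not _
        (fun σ : Equiv.Perm (Fin (n + 2)) × Fin (n + 2) => σ.1 0 = 0)]
    congr 1
    · refine Finset.sum_bij (fun σ _ => (extA σ.1, σ.2.succ)) ?_ ?_ ?_ ?_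
      · rintro ⟨σ, p⟩ h
        simp only [Finset.mem_filter, Finset.mem_univ, true_and] at h ⊢
        exact ⟨(uni_extA σ p).2 h, extA_zero σ⟩
      · rintro ⟨σ, p⟩ _ ⟨σ', p'⟩ _ h
        simp only [Prod.mk.injEq] at h
        rw [extA_inj h.1, Fin.succ_injective _ h.2]
      · rintro ⟨τ, p⟩ h
        simp only [Finset.mem_filter, Finset.mem_univ, true_and] at h
        obtain ⟨h, h0⟩ := h
        obtain ⟨σ, rfl⟩ := extA_surj τ h0
        have hp : p ≠ 0 := by
          rintro rfl
          have := h.2.2 0 (by omega) (le_refl _)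
          simp only [Fin.mk_zero] at this
          rw [h0] at this
          exact absurd this (Fin.not_lt_zero _)
        obtain ⟨q, rfl⟩ := Fin.exists_succ_eq.2 hp
        refine ⟨(σ, q), ?_, rfl⟩
        simp only [Finset.mem_filter, Finset.mem_univ, true_and]
        exact (uni_extA σ q).1 h
      · rintro ⟨σ, p⟩ _
        rw [List.ofFn_succ (n := n + 1)]
        simp only [extA_succ, extA_zero, List.foldr_cons, lie_zsmul, Fin.val_succ,
          Nat.add_sub_add_right]
    · rw [← Finset.sum_neg_distrib]
      refine Finset.sum_bij (fun σ _ => (extB σ.1, σ.2.castSucc)) ?_ ?_ ?_ ?_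
      · rintro ⟨σ, p⟩ h
        simp only [Finset.mem_filter, Finset.mem_univ, true_and] at h ⊢
        refine ⟨(uni_extB σ p p.2).2 h, ?_⟩
        have := extB_castSucc σ 0
        rw [Fin.castSucc_zero] at this
        rw [this]
        exact Fin.succ_ne_zero _
      · rintro ⟨σ, p⟩ _ ⟨σ', p'⟩ _ h
        simp only [Prod.mk.injEq] at h
        rw [extB_inj h.1, Fin.castSucc_injective _ h.2]
      · rintro ⟨τ, p⟩ h
        simp only [Finset.mem_filter, Finset.mem_univ, true_and] at h
        obtain ⟨h, h0⟩ := h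
        have hl := uni_last τ p h h0
        obtain ⟨σ, rfl⟩ := extB_surj τ hl
        have hp : p ≠ Fin.last _ := by
          rintro rfl
          have := h.2.1 n (by omega) (by simp)
          have e : (⟨n + 1, by omega⟩ : Fin (n + 2)) = Fin.last (n + 1) := rfl
          rw [e, hl] at this
          exact absurd this (Fin.not_lt_zero _)
        obtain ⟨q, rfl⟩ := Fin.exists_castSucc_eq.2 hp
        refine ⟨(σ, q), ?_, rfl⟩
        simp only [Finset.mem_filter, Finset.mem_univ, true_and]
        exact (uni_extB σ q q.2).1 h
      · rintro ⟨σ, p⟩ _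
        have e : n + 1 - (p : ℕ) = (n - p) + 1 := by have := p.2; omega
        rw [List.ofFn_succ' (n := n + 1)]
        simp only [extB_castSucc, extB_last, List.concat_eq_append, List.foldr_append,
          List.foldr_cons, List.foldr_nil, Fin.val_castSucc, e, pow_succ, mul_neg, mul_one, neg_smul]

/-- For a Lie ring `L`, `n, m ≥ 1` and `x₁,…,xₙ, y₁,…,y_m ∈ L`,
`⁅[x₁,…,xₙ], [y₁,…,y_m]⁆ = Σ_α (−1)^{h(α)} [x_{α(1)},…,x_{α(n)}, y₁,…,y_m]`, the sum
running over all unimodal permutations `α` of `{1,…,n}` with peak at position `s` and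
`h(α) = n − s`. -/
theorem lie_rightBracket_rightBracket_eq_sum_unimodal {L : Type*} [LieRing L]
    (n m : ℕ) (hn : 1 ≤ n) (hm : 1 ≤ m) (x : Fin n → L) (y : Fin m → L) :
    ⁅rightBracket (List.ofFn x), rightBracket (List.ofFn y)⁆ =
      ∑ σ ∈ Finset.univ.filter
          (fun σ : Equiv.Perm (Fin n) × Fin n => IsUnimodalPeak σ.1 σ.2.val),
        ((-1 : ℤ) ^ (n - 1 - σ.2.val)) •
          rightBracket (List.ofFn (fun i => x (σ.1 i)) ++ List.ofFn y) := by
  obtain ⟨n, rfl⟩ : ∃ k, n = k + 1 := ⟨n - 1, by omega⟩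
  rw [main_foldr]
  refine Finset.sum_congr rfl fun σ _ => ?_
  rw [rb_append _ _ (by
    intro h
    have := congrArg List.length h
    simp at this
    omega)]
  simp only [Nat.add_sub_cancel]
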